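/- Let t ≥ 1. If G is a graph all of whose minors have thickness at most t, then χ_o(G) ≤ 12t − 1. -/

import Mathlib

open SimpleGraph

/-- The degree of a vertex, as the cardinality of its neighbor set. -/
noncomputable def deg {V : Type} (G : SimpleGraph V) (v : V) : ℕ := (G.neighborSet v).ncard

/-- `H` is a minor of `G`, via branch sets. -/
def IsMinor {W V : Type} (H : SimpleGraph W) (G : SimpleGraph V) : Prop :=
  ∃ B : W → Set V,
    (∀ w, (B w).Nonempty) ∧
    (∀ w, (G.induce (B w)).Connected) ∧
    (Pairwise fun w₁ w₂ => Disjoint (B w₁) (B w₂)) ∧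
    (∀ w₁ w₂, H.Adj w₁ w₂ → ∃ v₁ ∈ B w₁, ∃ v₂ ∈ B w₂, G.Adj v₁ v₂)

/-- A graph is planar iff it has no `K₅` and no `K₃,₃` minor (Wagner's theorem). -/
def IsPlanar {V : Type} (G : SimpleGraph V) : Prop :=
  ¬ IsMinor (completeGraph (Fin 5)) G ∧
  ¬ IsMinor (completeBipartiteGraph (Fin 3) (Fin 3)) G

/-- `G` has thickness at most `t`: its edge set partitions into `t` planar subgraphs. -/
def ThicknessLE {V : Type} (G : SimpleGraph V) (t : ℕ) : Prop :=
  ∃ c : Sym2 V → Fin t, ∀ i : Fin t,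
    IsPlanar (SimpleGraph.fromEdgeSet {e | e ∈ G.edgeSet ∧ c e = i})

/-- The thickness of a graph. -/
noncomputable def thickness {V : Type} (G : SimpleGraph V) : ℕ :=
  sInf {t | ThicknessLE G t}

/-- `φ` is an odd coloring of `G` with `k` colors. -/
def IsOddColoring {V : Type} (G : SimpleGraph V) {k : ℕ} (φ : V → Fin k) : Prop :=
  (∀ ⦃u v⦄, G.Adj u v → φ u ≠ φ v) ∧
  ∀ v : V, (G.neighborSet v).Nonempty →
    ∃ c : Fin k, Odd ({u | u ∈ G.neighborSet v ∧ φ u = c}.ncard)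

/-- The odd chromatic number of `G`. -/
noncomputable def oddChrom {V : Type} (G : SimpleGraph V) : ℕ :=
  sInf {k | ∃ φ : V → Fin k, IsOddColoring G φ}

/-- `G` is odd `k⁺`-critical. -/
def OddCritical {V : Type} (G : SimpleGraph V) (k : ℕ) : Prop :=
  k ≤ oddChrom G ∧ ∀ H : G.Subgraph, H ≠ ⊤ → oddChrom H.coe < k

/-- A vertex is `n`-easy if its degree is odd or it has a neighbor of degree `2i`, `1 ≤ i ≤ n`. -/
def NEasy {V : Type} (G : SimpleGraph V) (n : ℕ) (v : V) : Prop :=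
  Odd (deg G v) ∨ ∃ u ∈ G.neighborSet v, ∃ i, 1 ≤ i ∧ i ≤ n ∧ deg G u = 2 * i

section Minor

variable {U V W : Type}

theorem induce_singleton_connected (G : SimpleGraph V) (v : V) : (G.induce {v}).Connected := by
  have : Subsingleton ({v} : Set V) := inferInstance
  exact ⟨Preconnected.of_subsingleton⟩

theorem IsMinor.of_le {H G : SimpleGraph V} (h : H ≤ G) : IsMinor H G :=
  ⟨fun v => {v}, fun v => Set.singleton_nonempty v, fun v => induce_singleton_connected G v,
    fun x y h => by simpa using h, fun x y hxy => ⟨x, rfl, y, rfl, h hxy⟩⟩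

theorem IsMinor.refl (G : SimpleGraph V) : IsMinor G G :=
  .of_le le_rfl

theorem IsMinor.trans {K : SimpleGraph U} {H : SimpleGraph W} {G : SimpleGraph V}
    (hKH : IsMinor K H) (hHG : IsMinor H G) : IsMinor K G := by
  obtain ⟨C, hCne, hCconn, hCdisj, hCadj⟩ := hKH
  obtain ⟨B, hBne, hBconn, hBdisj, hBadj⟩ := hHG
  refine ⟨fun k => ⋃ x ∈ C k, B x, fun k => ?_, fun k => ?_, fun k₁ k₂ hk => ?_,
    fun k₁ k₂ hk => ?_⟩
  · obtain ⟨x, hx⟩ := hCne k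
    obtain ⟨v, hv⟩ := hBne x
    exact ⟨v, Set.mem_biUnion hx hv⟩
  · have inner (x : W) (hx : x ∈ C k) (a b : V) (ha : a ∈ B x) (hb : b ∈ B x) :
        (G.induce (⋃ x ∈ C k, B x)).Reachable ⟨a, Set.mem_biUnion hx ha⟩
          ⟨b, Set.mem_biUnion hx hb⟩ :=
      ((hBconn x).preconnected ⟨a, ha⟩ ⟨b, hb⟩).map
        (G.induceHomOfLE (Set.subset_biUnion_of_mem hx)).toHom
    have outer (x y : C k) (p : (H.induce (C k)).Walk x y) :
        ∀ (a b : V) (ha : a ∈ B x) (hb : b ∈ B y),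
          (G.induce (⋃ x ∈ C k, B x)).Reachable ⟨a, Set.mem_biUnion x.2 ha⟩
            ⟨b, Set.mem_biUnion y.2 hb⟩ := by
      induction p with
      | nil => exact fun a b ha hb => inner _ (Subtype.prop _) a b ha hb
      | @cons x z y hxz _ ih =>
        intro a b ha hb
        obtain ⟨p, hp, q, hq, hpq⟩ := hBadj x z hxz
        have hstep : (G.induce (⋃ x ∈ C k, B x)).Adj ⟨p, Set.mem_biUnion x.2 hp⟩
            ⟨q, Set.mem_biUnion z.2 hq⟩ := hpq
        exact (inner x x.2 a p ha hp).trans (hstep.reachable.trans (ih q b hq hb))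
    obtain ⟨x, hx⟩ := hCne k
    obtain ⟨v, hv⟩ := hBne x
    have : Nonempty ↑(⋃ x ∈ C k, B x) := ⟨⟨v, Set.mem_biUnion hx hv⟩⟩
    refine ⟨fun a b => ?_⟩
    obtain ⟨a, ha⟩ := a
    obtain ⟨b, hb⟩ := b
    obtain ⟨x, hx, hax⟩ := Set.mem_iUnion₂.mp ha
    obtain ⟨y, hy, hby⟩ := Set.mem_iUnion₂.mp hb
    obtain ⟨p⟩ := (hCconn k).preconnected ⟨x, hx⟩ ⟨y, hy⟩
    exact outer _ _ p a b hax hby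
  · simp only [Set.disjoint_iUnion_left, Set.disjoint_iUnion_right]
    intro x hx y hy
    refine hBdisj ?_
    rintro rfl
    exact Set.disjoint_left.mp (hCdisj hk) (by assumption) (by assumption)
  · obtain ⟨x, hx, y, hy, hxy⟩ := hCadj k₁ k₂ hk
    obtain ⟨a, ha, b, hb, hab⟩ := hBadj x y hxy
    exact ⟨a, Set.mem_biUnion hx ha, b, Set.mem_biUnion hy hb, hab⟩

theorem isMinor_induce (G : SimpleGraph V) (s : Set V) : IsMinor (G.induce s) G :=
  ⟨fun v => {v.1}, fun v => Set.singleton_nonempty _, fun v => induce_singleton_connected G v,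
    fun x y h => by simpa [Subtype.ext_iff] using h, fun x y hxy => ⟨x, rfl, y, rfl, hxy⟩⟩

theorem IsMinor.finite {H : SimpleGraph W} {G : SimpleGraph V} [Finite V] (h : IsMinor H G) :
    Finite W := by
  obtain ⟨B, hne, -, hdisj, -⟩ := h
  choose f hf using hne
  refine Finite.of_injective f fun x y hxy => ?_
  by_contra hne
  exact Set.disjoint_left.mp (hdisj hne) (hf x) (hxy ▸ hf y)

/-- The graph obtained from `G` by contracting `v` into `u`. -/
def contractInto (G : SimpleGraph V) (u v : V) : SimpleGraph ({v}ᶜ : Set V) where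
  Adj x y := x ≠ y ∧ (G.Adj x y ∨ (x = u ∧ G.Adj v y) ∨ (y = u ∧ G.Adj v x))
  symm := ⟨fun x y h => ⟨h.1.symm, by have := G.adj_comm x y; tauto⟩⟩
  loopless := ⟨fun x h => h.1 rfl⟩

theorem induce_pair_connected_of_eq_or_adj {G : SimpleGraph V} {a b : V} (h : a = b ∨ G.Adj a b) :
    (G.induce {a, b}).Connected := by
  rcases h with rfl | h
  · rw [Set.pair_eq_singleton]
    exact induce_singleton_connected G a
  · exact induce_pair_connected_of_adj h

theorem isMinor_contractInto {G : SimpleGraph V} {u v : V} (h : G.Adj v u) :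
    IsMinor (contractInto G u v) G := by
  classical
  refine ⟨fun x => if x.1 = u then {u, v} else {x.1}, fun x => ?_, fun x => ?_,
    fun x y hxy => ?_, fun x y hxy => ?_⟩
  · dsimp only
    split_ifs <;> simp
  · dsimp only
    by_cases hx : x.1 = u
    · rw [if_pos hx]
      exact induce_pair_connected_of_adj h.symm
    · rw [if_neg hx]
      exact induce_singleton_connected G x
  · have hx : x.1 ≠ v := x.2
    have hy : y.1 ≠ v := y.2
    have hxy' : x.1 ≠ y.1 := fun h => hxy (Subtype.ext h)
    dsimp only
    rw [Set.disjoint_left]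
    split_ifs <;> simp <;> grind
  · obtain ⟨hne, h1 | ⟨h1, h2⟩ | ⟨h1, h2⟩⟩ := hxy
    · refine ⟨x, ?_, y, ?_, h1⟩ <;> dsimp only <;> split_ifs <;> simp_all
    · refine ⟨v, ?_, y, ?_, h2⟩ <;> dsimp only <;> split_ifs <;> simp_all
    · refine ⟨x, ?_, v, ?_, h2.symm⟩ <;> dsimp only <;> split_ifs <;> simp_all

/-- If `v` is adjacent to all of `a, b, d, e`, then `v`, `b`, `d`, `e` and the set `{a, c}`
span a `K₅` minor as soon as the remaining adjacencies hold. -/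
theorem isMinor_completeGraph_five {G : SimpleGraph V} {v a b c d e : V}
    (hac : a = c ∨ G.Adj a c) (hva : G.Adj v a) (hvb : G.Adj v b) (hvc : G.Adj v c)
    (hvd : G.Adj v d) (hve : G.Adj v e)
    (hbd : G.Adj b d) (hbe : G.Adj b e) (hde : G.Adj d e)
    (hcb : G.Adj c b) (had : G.Adj a d) (hae : G.Adj a e)
    (hab : a ≠ b) (hcd : c ≠ d) (hce : c ≠ e) :
    IsMinor (completeGraph (Fin 5)) G := by
  refine ⟨![{v}, {a, c}, {b}, {d}, {e}], fun i => ?_, fun i => ?_, fun i j hij => ?_,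
    fun i j hij => ?_⟩
  · fin_cases i <;> simp
  · fin_cases i
    exacts [induce_singleton_connected G v, induce_pair_connected_of_eq_or_adj hac,
      induce_singleton_connected G b, induce_singleton_connected G d, induce_singleton_connected G e]
  · have := hva.ne
    have := hvb.ne
    have := hvc.ne
    have := hvd.ne
    have := hve.ne
    have := hbd.ne
    have := hbe.ne
    have := hde.ne
    have := hcb.ne
    have := had.ne
    have := hae.ne
    fin_cases i <;> fin_cases j <;> first | exact absurd rfl hij | (simp; grind)
  · have hij : i ≠ j := hij
    have := hva.symm
    have := hvb.symm
    have := hvd.symm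
    have := hve.symm
    have := hbd.symm
    have := hbe.symm
    have := hde.symm
    have := hcb.symm
    have := had.symm
    have := hae.symm
    fin_cases i <;> fin_cases j <;> first | exact absurd rfl hij | simp [*]

end Minor

section EdgeBound

open Finset

variable {V : Type}

theorem ncard_edgeSet_eq_card_edgeFinset (G : SimpleGraph V) [Fintype G.edgeSet] :
    G.edgeSet.ncard = #G.edgeFinset :=
  Set.ncard_eq_toFinset_card' _

theorem deg_eq_degree (G : SimpleGraph V) (v : V) [Fintype (G.neighborSet v)] :
    deg G v = G.degree v :=
  Set.ncard_eq_toFinset_card' _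

theorem sum_deg_eq_two_mul_ncard_edgeSet [Fintype V] (G : SimpleGraph V) :
    ∑ v, deg G v = 2 * G.edgeSet.ncard := by
  classical
  rw [ncard_edgeSet_eq_card_edgeFinset, ← sum_degrees_eq_twice_card_edges]
  exact sum_congr rfl fun v _ => deg_eq_degree G v

theorem ncard_edgeSet_induce_compl_singleton [Finite V] (G : SimpleGraph V) (v : V) :
    (G.induce {v}ᶜ).edgeSet.ncard + deg G v = G.edgeSet.ncard := by
  classical
  have := Fintype.ofFinite V
  rw [ncard_edgeSet_eq_card_edgeFinset, ncard_edgeSet_eq_card_edgeFinset, deg_eq_degree,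
    card_edgeFinset_induce_compl_singleton, card_edgeFinset_deleteIncidenceSet]
  exact Nat.sub_add_cancel (degree_le_card_edgeFinset G v)

theorem induce_le_contractInto (G : SimpleGraph V) (u v : V) :
    G.induce {v}ᶜ ≤ contractInto G u v :=
  fun _ _ h => ⟨h.ne, .inl h⟩

theorem ncard_edgeSet_le_contractInto [Finite V] {G : SimpleGraph V} {u v : V} (h : G.Adj v u) :
    G.edgeSet.ncard ≤
      (contractInto G u v).edgeSet.ncard + 1 + (G.neighborSet v ∩ G.neighborSet u).ncard := by
  classical
  have := Fintype.ofFinite V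
  set A := G.neighborSet v ∩ G.neighborSet u
  set D := G.neighborSet v \ (insert u A) with hD
  have hdeg : deg G v ≤ D.ncard + 1 + A.ncard := by
    calc deg G v ≤ D.ncard + (insert u A).ncard := Set.ncard_le_ncard_sdiff_add_ncard _ _
      _ ≤ D.ncard + (A.ncard + 1) := by gcongr; exact Set.ncard_insert_le _ _
      _ = _ := by ring
  let f : V → Sym2 ({v}ᶜ : Set V) := fun y => if hy : y ≠ v then s(⟨u, h.ne'⟩, ⟨y, hy⟩) else
    s(⟨u, h.ne'⟩, ⟨u, h.ne'⟩)
  have hDv {y : V} (hy : y ∈ D) : y ≠ v := hy.1.ne'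
  have hDu {y : V} (hy : y ∈ D) : y ≠ u := fun h => hy.2 (h ▸ Set.mem_insert _ _)
  have hf {y : V} (hy : y ∈ D) : f y = s(⟨u, h.ne'⟩, ⟨y, hDv hy⟩) := dif_pos (hDv hy)
  have hinj : Set.InjOn f D := by
    intro x hx y hy hxy
    rw [hf hx, hf hy] at hxy
    exact congrArg Subtype.val (Sym2.congr_right.mp hxy)
  have hdisj : Disjoint (G.induce {v}ᶜ).edgeSet (f '' D) := by
    rw [Set.disjoint_right]
    rintro _ ⟨y, hy, rfl⟩ hmem
    rw [hf hy] at hmem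
    exact hy.2 (Set.mem_insert_of_mem _ ⟨hy.1, hmem⟩)
  have hsub : (G.induce {v}ᶜ).edgeSet ∪ f '' D ⊆ (contractInto G u v).edgeSet := by
    refine Set.union_subset (edgeSet_mono (induce_le_contractInto G u v)) ?_
    rintro _ ⟨y, hy, rfl⟩
    rw [hf hy]
    exact ⟨fun h => hDu hy (congrArg Subtype.val h).symm, .inr (.inl ⟨rfl, hy.1⟩)⟩
  have hle := Set.ncard_le_ncard hsub
  rw [Set.ncard_union_eq hdisj, hinj.ncard_image] at hle
  have := ncard_edgeSet_induce_compl_singleton G v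
  omega

/-- A vertex of degree four or five, each of whose neighbors has three neighbors in common with
it, yields a `K₅` minor. -/
theorem isMinor_completeGraph_five_of_common_neighbors [Finite V] {G : SimpleGraph V} {v : V}
    (h4 : 4 ≤ deg G v) (h5 : deg G v ≤ 5)
    (h : ∀ x, G.Adj v x → 3 ≤ (G.neighborSet v ∩ G.neighborSet x).ncard) :
    IsMinor (completeGraph (Fin 5)) G := by
  classical
  have := Fintype.ofFinite V
  set s := G.neighborFinset v with hs
  have hcard : #s = deg G v := (deg_eq_degree G v).symm
  have hv {x : V} : x ∈ s → G.Adj v x := (G.mem_neighborFinset v x).mp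
  replace h {x : V} (hx : x ∈ s) : 3 ≤ #{y ∈ s | G.Adj x y} := by
    have := h x (hv hx)
    rwa [show G.neighborSet v ∩ G.neighborSet x = ↑{y ∈ s | G.Adj x y} by ext; simp [hs],
      Set.ncard_coe_finset] at this
  by_cases hall : ∀ x ∈ s, ∀ y ∈ s, x ≠ y → G.Adj x y
  · obtain ⟨r, hrs, hr⟩ := exists_subset_card_eq (hcard ▸ h4 : 4 ≤ #s)
    obtain ⟨a, r', har, rfl, hr'⟩ := card_eq_succ.mp hr
    obtain ⟨b, d, e, hbd, hbe, hde, rfl⟩ := card_eq_three.mp hr'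
    simp only [insert_subset_iff, singleton_subset_iff, mem_insert, mem_singleton, not_or] at hrs har
    obtain ⟨ha, hb, hd, he⟩ := hrs
    obtain ⟨hab, had, hae⟩ := har
    exact isMinor_completeGraph_five (.inl rfl) (hv ha) (hv hb) (hv ha) (hv hd) (hv he)
      (hall _ hb _ hd hbd) (hall _ hb _ he hbe) (hall _ hd _ he hde) (hall _ ha _ hb hab)
      (hall _ ha _ hd had) (hall _ ha _ he hae) hab had hae
  · push Not at hall
    obtain ⟨a, ha, b, hb, hab, hnab⟩ := hall
    have hor {x y z : V} (hx : x ∈ s) (hy : y ∈ s) (hz : z ∈ s) (hxy : x ≠ y) (hxz : x ≠ z)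
        (hyz : y ≠ z) (hnxy : ¬ G.Adj x y) : #s = 5 ∧ G.Adj x z := by
      have hle : #{w ∈ s | G.Adj x w} ≤ #(s \ {x, y}) := card_le_card fun w hw => by
        simp only [mem_filter, mem_sdiff, mem_insert, mem_singleton] at hw ⊢
        refine ⟨hw.1, ?_⟩
        rintro (rfl | rfl)
        exacts [hw.2.ne rfl, hnxy hw.2]
      have h1 : #(s \ {x, y}) = #s - 2 := by
        rw [card_sdiff_of_subset (by simp [insert_subset_iff, hx, hy]), card_pair hxy]
      have h2 := h hx
      refine ⟨by omega, ?_⟩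
      by_contra hnxz
      have hle : #{w ∈ s | G.Adj x w} ≤ #(s \ {x, y, z}) := card_le_card fun w hw => by
        simp only [mem_filter, mem_sdiff, mem_insert, mem_singleton] at hw ⊢
        refine ⟨hw.1, ?_⟩
        rintro (rfl | rfl | rfl)
        exacts [hw.2.ne rfl, hnxy hw.2, hnxz hw.2]
      have h1 : #(s \ {x, y, z}) = #s - 3 := by
        rw [card_sdiff_of_subset (by simp [insert_subset_iff, hx, hy, hz]),
          card_eq_three.mpr ⟨x, y, z, hxy, hxz, hyz, rfl⟩]
      omega
    have hrest : 2 ≤ #(s \ {a, b}) := by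
      rw [card_sdiff_of_subset (by simp [insert_subset_iff, ha, hb]), card_pair hab]
      omega
    have hs5 : #s = 5 := by
      obtain ⟨z, hz⟩ : (s \ {a, b}).Nonempty := card_pos.mp (by omega)
      simp only [mem_sdiff, mem_insert, mem_singleton, not_or] at hz
      exact (hor ha hb hz.1 hab (Ne.symm hz.2.1) (Ne.symm hz.2.2) hnab).1
    have hthree : #(s \ {a, b}) = 3 := by
      rw [card_sdiff_of_subset (by simp [insert_subset_iff, ha, hb]), card_pair hab, hs5]
    obtain ⟨c, d, e, hcd, hce, hde, hcde⟩ := card_eq_three.mp hthree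
    have hmem (x : V) (hx : x ∈ ({c, d, e} : Finset V)) :
        x ∈ s ∧ x ≠ a ∧ x ≠ b ∧ G.Adj a x ∧ G.Adj b x := by
      rw [← hcde] at hx
      simp only [mem_sdiff, mem_insert, mem_singleton, not_or] at hx
      obtain ⟨hx, hxa, hxb⟩ := hx
      exact ⟨hx, hxa, hxb, (hor ha hb hx hab (Ne.symm hxa) (Ne.symm hxb) hnab).2,
        (hor hb ha hx hab.symm (Ne.symm hxb) (Ne.symm hxa) fun h => hnab h.symm).2⟩
    obtain ⟨hc, hca, hcb, hac, hbc⟩ := hmem c (by simp)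
    obtain ⟨hd, hda, hdb, had, hbd⟩ := hmem d (by simp)
    obtain ⟨he, hea, heb, hae, hbe⟩ := hmem e (by simp)
    by_cases hadj : G.Adj d e
    · exact isMinor_completeGraph_five (.inr hac) (hv ha) (hv hb) (hv hc) (hv hd) (hv he)
        hbd hbe hadj hbc.symm had hae hab hcd hce
    · have hdc := (hor hd he hc hde hcd.symm hce.symm hadj).2
      exact isMinor_completeGraph_five (.inr hae) (hv ha) (hv hb) (hv he) (hv hd) (hv hc)
        hbd hbc hdc hbe.symm had hac hab hde.symm hce.symm

theorem card_compl_singleton_add_one [Fintype V] (v : V) [Fintype ({v}ᶜ : Set V)] :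
    Fintype.card ({v}ᶜ : Set V) + 1 = Fintype.card V := by
  classical
  have := Fintype.card_pos_iff.mpr ⟨v⟩
  rw [Fintype.card_compl_set]
  simp
  omega

theorem isMinor_completeGraph_five_of_ncard_edgeSet [Fintype V] (G : SimpleGraph V)
    (hV : 3 ≤ Fintype.card V) (hG : 3 * Fintype.card V < G.edgeSet.ncard + 6) :
    IsMinor (completeGraph (Fin 5)) G := by
  classical
  induction hn : Fintype.card V using Nat.strong_induction_on generalizing V with
  | _ n ih =>
  subst hn
  have hV4 : 4 ≤ Fintype.card V := by
    by_contra hlt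
    have h3 : Fintype.card V = 3 := by omega
    have hle := G.card_edgeFinset_le_card_choose_two
    rw [← ncard_edgeSet_eq_card_edgeFinset, h3] at hle
    simp [Nat.choose] at hle
    omega
  obtain ⟨E, hEG, hE⟩ := Set.exists_subset_card_eq
    (show 3 * Fintype.card V - 5 ≤ G.edgeSet.ncard by omega)
  have hEdge : (fromEdgeSet E).edgeSet = E :=
    (edgeSet_fromEdgeSet E).trans (sdiff_eq_left.mpr
      (Set.disjoint_left.mpr fun e he => G.not_isDiag_of_mem_edgeSet (hEG he)))
  have hle : fromEdgeSet E ≤ G := edgeSet_subset_edgeSet.mp (hEdge.trans_subset hEG)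
  rw [← hEdge] at hE
  refine IsMinor.trans ?_ (.of_le hle)
  clear hG hEG hle
  generalize fromEdgeSet E = G at hE
  have hstep {v : V} (H : SimpleGraph ({v}ᶜ : Set V)) (hH : IsMinor H G)
      (hle : G.edgeSet.ncard ≤ H.edgeSet.ncard + 3) : IsMinor (completeGraph (Fin 5)) G := by
    have := card_compl_singleton_add_one v
    exact (ih _ (by omega) H (by omega) (by omega) rfl).trans hH
  obtain ⟨v, hv⟩ : ∃ v, deg G v ≤ 5 := by
    by_contra! hdeg
    have hsum : ∑ _v : V, 6 ≤ ∑ v, deg G v := sum_le_sum fun v _ => hdeg v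
    rw [sum_deg_eq_two_mul_ncard_edgeSet] at hsum
    simp at hsum
    omega
  have hind := ncard_edgeSet_induce_compl_singleton G v
  by_cases hv3 : deg G v ≤ 3
  · exact hstep _ (isMinor_induce G {v}ᶜ) (by omega)
  by_cases hcommon : ∀ x, G.Adj v x → 3 ≤ (G.neighborSet v ∩ G.neighborSet x).ncard
  · exact isMinor_completeGraph_five_of_common_neighbors (by omega) hv hcommon
  push Not at hcommon
  obtain ⟨x, hvx, hx⟩ := hcommon
  have hle := ncard_edgeSet_le_contractInto hvx
  exact hstep _ (isMinor_contractInto hvx) (by omega)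

theorem IsPlanar.ncard_edgeSet_lt [Fintype V] [Nonempty V] {G : SimpleGraph V} (h : IsPlanar G) :
    G.edgeSet.ncard < 3 * Fintype.card V := by
  classical
  by_contra! hge
  have hpos : 0 < Fintype.card V := Fintype.card_pos
  refine h.1 (isMinor_completeGraph_five_of_ncard_edgeSet G ?_ (by omega))
  by_contra! hlt
  have hle := G.card_edgeFinset_le_card_choose_two
  rw [← ncard_edgeSet_eq_card_edgeFinset] at hle
  interval_cases Fintype.card V <;> simp only [Nat.choose] at hle <;> omega

end EdgeBound

section Thickness

open Finset

variable {V W : Type}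

theorem not_isMinor_of_subsingleton_edgeSet {H : SimpleGraph W} {G : SimpleGraph V}
    (hG : G.edgeSet.Subsingleton) {a b c d : W} (hab : H.Adj a b) (hcd : H.Adj c d)
    (hac : a ≠ c) (had : a ≠ d) : ¬ IsMinor H G := by
  rintro ⟨B, -, -, hdisj, hadj⟩
  obtain ⟨x, hx, y, hy, hxy⟩ := hadj a b hab
  obtain ⟨z, hz, w, hw, hzw⟩ := hadj c d hcd
  have heq : s(x, y) = s(z, w) := hG hxy hzw
  rcases Sym2.eq_iff.mp heq with ⟨rfl, -⟩ | ⟨rfl, -⟩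
  · exact Set.disjoint_left.mp (hdisj hac) hx hz
  · exact Set.disjoint_left.mp (hdisj had) hx hw

theorem isPlanar_of_subsingleton_edgeSet {G : SimpleGraph V} (hG : G.edgeSet.Subsingleton) :
    IsPlanar G :=
  ⟨not_isMinor_of_subsingleton_edgeSet hG (a := 0) (b := 1) (c := 2) (d := 3)
      (by simp) (by simp) (by simp) (by simp),
    not_isMinor_of_subsingleton_edgeSet hG (a := .inl 0) (b := .inr 0) (c := .inl 1) (d := .inr 1)
      (by simp) (by simp) (by simp) (by simp)⟩

theorem edgeSet_fromEdgeSet_color_class (G : SimpleGraph V) {k : ℕ} (c : Sym2 V → Fin k)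
    (i : Fin k) :
    (fromEdgeSet {e | e ∈ G.edgeSet ∧ c e = i}).edgeSet = {e | e ∈ G.edgeSet ∧ c e = i} :=
  (edgeSet_fromEdgeSet _).trans (sdiff_eq_left.mpr
    (Set.disjoint_left.mpr fun _ he => G.not_isDiag_of_mem_edgeSet he.1))

theorem thicknessLE_thickness [Finite V] (G : SimpleGraph V) : ThicknessLE G (thickness G) := by
  refine Nat.sInf_mem (s := {t | ThicknessLE G t})
    ⟨Nat.card (Sym2 V), Finite.equivFin (Sym2 V), fun i => isPlanar_of_subsingleton_edgeSet ?_⟩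
  rw [edgeSet_fromEdgeSet_color_class]
  exact fun e he f hf => (Finite.equivFin (Sym2 V)).injective (he.2.trans hf.2.symm)

theorem exists_deg_lt_of_thickness_le [Finite V] [Nonempty V] {G : SimpleGraph V} {t : ℕ}
    (ht : 1 ≤ t) (h : thickness G ≤ t) : ∃ v, deg G v < 6 * t := by
  classical
  have := Fintype.ofFinite V
  obtain ⟨c, hc⟩ := thicknessLE_thickness G
  have hcard : G.edgeSet.ncard ≤ t * (3 * Fintype.card V - 1) := by
    calc G.edgeSet.ncard = ∑ i, #{e ∈ G.edgeFinset | c e = i} := by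
          rw [ncard_edgeSet_eq_card_edgeFinset]
          exact card_eq_sum_card_fiberwise fun _ _ => mem_univ _
      _ ≤ ∑ _i : Fin (thickness G), (3 * Fintype.card V - 1) := sum_le_sum fun i _ => by
          have hlt := (hc i).ncard_edgeSet_lt
          rw [edgeSet_fromEdgeSet_color_class,
            show {e | e ∈ G.edgeSet ∧ c e = i} = ↑{e ∈ G.edgeFinset | c e = i} by ext; simp,
            Set.ncard_coe_finset] at hlt
          omega
      _ ≤ t * (3 * Fintype.card V - 1) := by
          simpa using Nat.mul_le_mul_right _ h
  by_contra! hdeg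
  have hsum : ∑ _v : V, 6 * t ≤ ∑ v, deg G v := sum_le_sum fun v _ => hdeg v
  rw [sum_deg_eq_two_mul_ncard_edgeSet, sum_const, card_univ, smul_eq_mul] at hsum
  have hpos : 0 < Fintype.card V := Fintype.card_pos
  obtain ⟨m, hm⟩ := Nat.exists_eq_add_of_lt hpos
  rw [hm] at hcard hsum
  have : 3 * (0 + m + 1) - 1 = 3 * m + 2 := by omega
  rw [this] at hcard
  nlinarith

end Thickness

section OddColoring

open Finset

variable {V : Type}

/-- An odd coloring of a graph `H` on the complement of `v` extends to `G`, provided that `H` is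
obtained from `G - v` by adding edges between neighbors of `v` in such a way that some neighbor
of `v` becomes adjacent to all others. -/
theorem exists_isOddColoring_of_compl_singleton [Finite V] {G : SimpleGraph V} {v : V}
    {H : SimpleGraph ({v}ᶜ : Set V)} {k : ℕ} (hk : 2 * deg G v < k)
    (hle : G.induce {v}ᶜ ≤ H) (hout : ∀ x y, H.Adj x y → ¬ G.Adj v x → G.Adj x y)
    (hhub : (G.neighborSet v).Nonempty →
      ∃ u, G.Adj v u ∧ ∀ x : ({v}ᶜ : Set V), G.Adj v x → x.1 ≠ u →
        ∃ hu : u ≠ v, H.Adj ⟨u, hu⟩ x)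
    {φ : ({v}ᶜ : Set V) → Fin k} (hφ : IsOddColoring H φ) :
    ∃ ψ : V → Fin k, IsOddColoring G ψ := by
  classical
  have := Fintype.ofFinite V
  obtain ⟨hproper, hodd⟩ := hφ
  have hk0 : 0 < k := by omega
  set φ' : V → Fin k := fun x => if hx : x ≠ v then φ ⟨x, hx⟩ else ⟨0, hk0⟩
  have hφ' {x : V} (hx : x ≠ v) : φ' x = φ ⟨x, hx⟩ := dif_pos hx
  have hproper' {x y : V} (hx : x ≠ v) (hy : y ≠ v) (h : H.Adj ⟨x, hx⟩ ⟨y, hy⟩) :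
      φ' x ≠ φ' y := by
    rw [hφ' hx, hφ' hy]
    exact hproper h
  let S (w : V) (c : Fin k) : Set V := {x | G.Adj w x ∧ x ≠ v ∧ φ' x = c}
  choose o ho using fun w : V => show ∃ c : Fin k, (∃ c', Odd (S w c').ncard) → Odd (S w c).ncard by
    by_cases h : ∃ c', Odd (S w c').ncard
    · exact ⟨h.choose, fun _ => h.choose_spec⟩
    · exact ⟨⟨0, hk0⟩, fun h' => absurd h' h⟩
  set F := (G.neighborFinset v).image φ' ∪ (G.neighborFinset v).image o
  have hF : #F < #(univ : Finset (Fin k)) := by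
    have h1 : #F ≤ #(G.neighborFinset v) + #(G.neighborFinset v) :=
      (card_union_le _ _).trans (add_le_add card_image_le card_image_le)
    rw [card_neighborFinset_eq_degree, ← deg_eq_degree] at h1
    rw [card_univ, Fintype.card_fin]
    omega
  obtain ⟨c, -, hc⟩ := exists_mem_notMem_of_card_lt_card hF
  have hcφ {w : V} (hw : G.Adj v w) : φ' w ≠ c := fun h => hc
    (mem_union_left _ (mem_image.mpr ⟨w, (G.mem_neighborFinset v w).mpr hw, h⟩))
  have hco {w : V} (hw : G.Adj v w) : o w ≠ c := fun h => hc
    (mem_union_right _ (mem_image.mpr ⟨w, (G.mem_neighborFinset v w).mpr hw, h⟩))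
  set ψ : V → Fin k := Function.update φ' v c
  have hψv : ψ v = c := Function.update_self ..
  have hψ {x : V} (hx : x ≠ v) : ψ x = φ' x := Function.update_of_ne hx ..
  refine ⟨ψ, fun x y hxy => ?_, fun w hw => ?_⟩
  · by_cases hx : x = v
    · subst hx
      rw [hψv, hψ hxy.ne']
      exact (hcφ hxy).symm
    · by_cases hy : y = v
      · subst hy
        rw [hψv, hψ hx]
        exact hcφ hxy.symm
      · rw [hψ hx, hψ hy]
        exact hproper' hx hy (hle hxy)
  · by_cases hwv : w = v
    · subst hwv
      obtain ⟨u, hu, hhub⟩ := hhub hw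
      have hset : {x | x ∈ G.neighborSet w ∧ ψ x = ψ u} = {u} := by
        ext x
        refine ⟨fun ⟨hx, hxu⟩ => ?_, ?_⟩
        · by_contra hne
          have hx : G.Adj w x := hx
          obtain ⟨_, hadj⟩ := hhub ⟨x, hx.ne'⟩ hx hne
          rw [hψ hx.ne', hψ hu.ne'] at hxu
          exact hproper' hu.ne' hx.ne' hadj hxu.symm
        · rintro rfl
          exact ⟨hu, rfl⟩
      exact ⟨ψ u, by rw [hset, Set.ncard_singleton]; exact odd_one⟩
    by_cases hvw : G.Adj v w
    · by_cases hex : ∃ c', Odd (S w c').ncard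
      · refine ⟨o w, ?_⟩
        have hset : {x | x ∈ G.neighborSet w ∧ ψ x = o w} = S w (o w) := by
          ext x
          by_cases hx : x = v
          · subst hx
            simp [S, hψv, (hco hvw).symm]
          · simp [S, hψ hx, hx]
        rw [hset]
        exact ho w hex
      · refine ⟨c, ?_⟩
        have hset : {x | x ∈ G.neighborSet w ∧ ψ x = c} = insert v (S w c) := by
          ext x
          by_cases hx : x = v
          · subst hx
            simp [hψv, hvw.symm]
          · simp [S, hψ hx, hx]
        rw [hset, Set.ncard_insert_of_notMem fun h => h.2.1 rfl]
        push Not at hex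
        exact (Nat.not_odd_iff_even.mp (hex c)).add_one
    · obtain ⟨y, hy⟩ := hw
      have hne {x : V} (hx : G.Adj w x) : x ≠ v := fun h => hvw (h ▸ hx).symm
      obtain ⟨c', hc'⟩ := hodd ⟨w, hwv⟩ ⟨⟨y, hne hy⟩, hle hy⟩
      refine ⟨c', ?_⟩
      have hset : {x | x ∈ G.neighborSet w ∧ ψ x = c'} =
          Subtype.val '' {x | x ∈ H.neighborSet ⟨w, hwv⟩ ∧ φ x = c'} := by
        ext x
        constructor
        · rintro ⟨hx, hxc⟩
          refine ⟨⟨x, hne hx⟩, ⟨hle hx, ?_⟩, rfl⟩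
          rwa [hψ (hne hx), hφ' (hne hx)] at hxc
        · rintro ⟨x, ⟨hx, hxc⟩, rfl⟩
          refine ⟨hout _ _ hx hvw, ?_⟩
          rwa [hψ x.2, hφ' x.2]
      rwa [hset, Set.ncard_image_of_injective _ Subtype.val_injective]

/-- If every nonempty minor of `G` has a vertex of degree at most `d`, then `G` has an odd
coloring with `2 * d + 1` colors. -/
theorem exists_isOddColoring_of_minors_deg_le [Fintype V] (G : SimpleGraph V) (d : ℕ)
    (h : ∀ (W : Type) (H : SimpleGraph W), Nonempty W → IsMinor H G → ∃ w, deg H w ≤ d) :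
    ∃ φ : V → Fin (2 * d + 1), IsOddColoring G φ := by
  classical
  induction hn : Fintype.card V using Nat.strong_induction_on generalizing V with
  | _ n ih =>
  subst hn
  rcases isEmpty_or_nonempty V with hV | hV
  · exact ⟨isEmptyElim, fun u => isEmptyElim u, isEmptyElim⟩
  obtain ⟨v, hv⟩ := h V G hV (.refl G)
  have hcard := card_compl_singleton_add_one v
  have hcolor (H : SimpleGraph ({v}ᶜ : Set V)) (hH : IsMinor H G) :
      ∃ φ : ({v}ᶜ : Set V) → Fin (2 * d + 1), IsOddColoring H φ :=
    ih _ (by omega) H (fun W K hW hK => h W K hW (hK.trans hH)) rfl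
  by_cases hN : (G.neighborSet v).Nonempty
  · obtain ⟨u, hu⟩ := hN
    obtain ⟨φ, hφ⟩ := hcolor _ (isMinor_contractInto hu)
    refine exists_isOddColoring_of_compl_singleton (by omega) (induce_le_contractInto G u v)
      ?_ (fun _ => ⟨u, hu, fun x hx hxu => ⟨hu.ne', ?_⟩⟩) hφ
    · rintro x y ⟨-, hxy | ⟨hx, -⟩ | ⟨-, hx⟩⟩ hvx
      exacts [hxy, absurd (hx ▸ hu) hvx, absurd hx hvx]
    · exact ⟨fun h => hxu (congrArg Subtype.val h).symm, .inr (.inl ⟨rfl, hx⟩)⟩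
  · obtain ⟨φ, hφ⟩ := hcolor _ (isMinor_induce G {v}ᶜ)
    exact exists_isOddColoring_of_compl_singleton (by omega) le_rfl (fun _ _ h _ => h)
      (fun h => absurd h hN) hφ

end OddColoring

/-- If every minor of `G` has thickness at most `t` (`t ≥ 1`), then `χ_o(G) ≤ 12t − 1`. -/
theorem oddChrom_le_of_minors_thickness {V : Type} [Fintype V] (G : SimpleGraph V)
    (t : ℕ) (ht : 1 ≤ t)
    (h : ∀ (W : Type) (H : SimpleGraph W), IsMinor H G → thickness H ≤ t) :
    oddChrom G ≤ 12 * t - 1 := by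
  obtain ⟨φ, hφ⟩ := exists_isOddColoring_of_minors_deg_le G (6 * t - 1) fun W H _ hH => by
    have := hH.finite
    obtain ⟨w, hw⟩ := exists_deg_lt_of_thickness_le ht (h W H hH)
    exact ⟨w, by omega⟩
  have hk : 2 * (6 * t - 1) + 1 = 12 * t - 1 := by omega
  exact hk ▸ Nat.sInf_le ⟨φ, hφ⟩
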